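/- Let (π, π') be a chainable and non-redundant pair of patterns and set r := r(π, π'). Then for any X ∈ D^π and Y ∈ D^{π'}: (1) there exist X̃ ∈ D^π and Ỹ ∈ D^{π'} such that X̃Ỹ = XY and X̃ is left-r-unitary; (2) there exist X̃ ∈ D^π and Ỹ ∈ D^{π'} such that X̃Ỹ = XY and Ỹ is right-r-unitary. -/

import Mathlib

/-- A *pattern* is a tuple `(a, b, c, d)` of (positive) natural numbers. -/
structure Pattern where
  a : ℕ
  b : ℕ
  c : ℕ
  d : ℕ

namespace Pattern

/-- The entries of a pattern are positive integers. -/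
def Pos (π : Pattern) : Prop := 0 < π.a ∧ 0 < π.b ∧ 0 < π.c ∧ 0 < π.d

/-- Number of rows `a*b*d` of a `π`-factor. -/
def rows (π : Pattern) : ℕ := π.a * π.b * π.d

/-- Number of columns `a*c*d` of a `π`-factor. -/
def cols (π : Pattern) : ℕ := π.a * π.c * π.d

/-- `r(π₁, π₂) = a₁c₁/a₂ (= b₂d₂/d₁)`. -/
def rk (π₁ π₂ : Pattern) : ℕ := π₁.a * π₁.c / π₂.a

/-- A pair of patterns is *chainable* if `a₁c₁/a₂ = b₂d₂/d₁` is a positive integer,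
`a₁ ∣ a₂` and `d₂ ∣ d₁`. -/
def Chainable (π₁ π₂ : Pattern) : Prop :=
  π₂.a ∣ π₁.a * π₁.c ∧ π₁.d ∣ π₂.b * π₂.d ∧
    π₁.a * π₁.c / π₂.a = π₂.b * π₂.d / π₁.d ∧
    0 < π₁.a * π₁.c / π₂.a ∧ π₁.a ∣ π₂.a ∧ π₂.d ∣ π₁.d

/-- `π₁ * π₂ := (a₁, b₁d₁/d₂, a₂c₂/a₁, d₂)`. -/
instance : Mul Pattern :=
  ⟨fun π₁ π₂ => ⟨π₁.a, π₁.b * π₁.d / π₂.d, π₂.a * π₂.c / π₁.a, π₂.d⟩⟩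

/-- `‖π‖₀ := a*b*c*d`. -/
def norm0 (π : Pattern) : ℕ := π.a * π.b * π.c * π.d

end Pattern

open scoped Kronecker

/-- The flattening equivalence `(Fin a × Fin b) × Fin d ≃ Fin (a*b*d)`. -/
def kron3Equiv (a b d : ℕ) : (Fin a × Fin b) × Fin d ≃ Fin (a * b * d) :=
  (finProdFinEquiv.prodCongr (Equiv.refl (Fin d))).trans finProdFinEquiv

/-- The support matrix `S_π = I_a ⊗ 1_{b×c} ⊗ I_d ∈ {0,1}^{abd × acd}`. -/
def Pattern.S (π : Pattern) : Matrix (Fin π.rows) (Fin π.cols) ℕ :=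
  Matrix.reindex (kron3Equiv π.a π.b π.d) (kron3Equiv π.a π.c π.d)
    ((1 : Matrix (Fin π.a) (Fin π.a) ℕ) ⊗ₖ
      (Matrix.of fun _ _ => (1 : ℕ) : Matrix (Fin π.b) (Fin π.c) ℕ) ⊗ₖ
      (1 : Matrix (Fin π.d) (Fin π.d) ℕ))

/-- The support matrix `S_π`, extended by zero to an `ℕ × ℕ`-indexed array. -/
def SpatN (π : Pattern) : ℕ → ℕ → ℕ := fun i j =>
  if h : i < π.rows ∧ j < π.cols then π.S ⟨i, h.1⟩ ⟨j, h.2⟩ else 0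

/-- `X` is (the extension by zero of) a `π`-factor: it vanishes outside the support of `S_π`. -/
def IsFactorN (π : Pattern) (X : ℕ → ℕ → ℂ) : Prop :=
  ∀ i j, SpatN π i j = 0 → X i j = 0

/-- Product of matrices encoded as finitely supported `ℕ × ℕ`-indexed arrays. -/
noncomputable def nmul (f g : ℕ → ℕ → ℂ) : ℕ → ℕ → ℂ := fun i j => ∑' k, f i k * g k j

/-- `nprod X k = X 0 * X 1 * ⋯ * X k`. -/
noncomputable def nprod (X : ℕ → ℕ → ℕ → ℂ) : ℕ → ℕ → ℕ → ℂ
  | 0 => X 0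
  | k + 1 => nmul (nprod X k) (X (k + 1))

/-- Frobenius norm. -/
noncomputable def nfrob (f : ℕ → ℕ → ℂ) : ℝ := Real.sqrt (∑' i, ∑' j, ‖f i j‖ ^ 2)

/-- `A` is (the extension by zero of) a matrix of size `m × n`. -/
def SuppIn (m n : ℕ) (A : ℕ → ℕ → ℂ) : Prop := ∀ i j, A i j ≠ 0 → i < m ∧ j < n

/-- A chainable pair is *redundant* if `r(π₁,π₂) ≥ min (b₁, c₂)`. -/
def RedundantPair (π₁ π₂ : Pattern) : Prop := min π₁.b π₂.c ≤ Pattern.rk π₁ π₂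

/-- A `π`-factor `X` is *left-`r`-unitary* if `r ∣ c` and `‖XY‖_F = ‖Y‖_F` for every
`π'`-factor `Y` with `(π, π')` chainable and `r(π, π') = r`. -/
def LeftRUnitary (π : Pattern) (r : ℕ) (X : ℕ → ℕ → ℂ) : Prop :=
  r ∣ π.c ∧ ∀ π' : Pattern, π'.Pos → Pattern.Chainable π π' → Pattern.rk π π' = r →
    ∀ Y : ℕ → ℕ → ℂ, IsFactorN π' Y → nfrob (nmul X Y) = nfrob Y

/-- A `π`-factor `X` is *right-`r`-unitary* if `r ∣ b` and `‖YX‖_F = ‖Y‖_F` for every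
`π'`-factor `Y` with `(π', π)` chainable and `r(π', π) = r`. -/
def RightRUnitary (π : Pattern) (r : ℕ) (X : ℕ → ℕ → ℂ) : Prop :=
  r ∣ π.b ∧ ∀ π' : Pattern, π'.Pos → Pattern.Chainable π' π → Pattern.rk π' π = r →
    ∀ Y : ℕ → ℕ → ℂ, IsFactorN π' Y → nfrob (nmul Y X) = nfrob Y

open scoped ComplexConjugate

/-- Any `r` vectors are combinations of `r` orthonormal ones, if the dimension allows. -/
theorem exists_orthonormal_expansion {E : Type*} [NormedAddCommGroup E] [InnerProductSpace ℂ E]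
    [FiniteDimensional ℂ E] {ι : Type*} [Fintype ι] (hr : Fintype.card ι ≤ Module.finrank ℂ E)
    (v : ι → E) :
    ∃ q : ι → E, Orthonormal ℂ q ∧ ∀ k, v k = ∑ l, inner ℂ (q l) (v k) • q l := by
  classical
  let e := Fintype.equivFin ι
  let g : ι → Fin (Module.finrank ℂ E) := fun x => Fin.castLE hr (e x)
  have hg : Function.Injective g := (Fin.castLE_injective hr).comp e.injective
  let f : Fin (Module.finrank ℂ E) → E := fun j =>
    if h : j.1 < Fintype.card ι then v (e.symm ⟨j, h⟩) else 0
  have hf : ∀ k, f (g k) = v k := fun k => by simp [f, g]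
  let b := InnerProductSpace.gramSchmidtOrthonormalBasis
    (Fintype.card_fin (Module.finrank ℂ E)).symm f
  refine ⟨fun k => b (g k), b.orthonormal.comp g hg, fun k => ?_⟩
  rw [← hf k]
  conv_lhs => rw [← b.sum_repr' (f (g k))]
  symm
  rw [← Finset.sum_image (s := Finset.univ) (g := g)
    (f := fun j => inner ℂ (b j) (f (g k)) • b j) (fun x _ y _ h => hg h)]
  refine Finset.sum_subset (Finset.subset_univ _) fun j _ hj => ?_
  have hlt : g k < j := by
    by_contra hle
    have hj' : j.1 < Fintype.card ι := by
      have : j.1 ≤ (g k).1 := not_lt.mp hle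
      exact this.trans_lt (e k).2
    exact hj (Finset.mem_image.mpr ⟨e.symm ⟨j, hj'⟩, Finset.mem_univ _, by simp [g]⟩)
  rw [InnerProductSpace.gramSchmidtOrthonormalBasis_inv_triangular _ _ hlt, zero_smul]

/-- Thin QR factorization of the submatrix of `X` with rows `R` and columns `C`. -/
theorem exists_thin_qr (R C : Finset ℕ) (hRC : C.card ≤ R.card) (X : ℕ → ℕ → ℂ) :
    ∃ Q A : ℕ → ℕ → ℂ,
      (∀ i k, i ∉ R → Q i k = 0) ∧
      (∀ k ∈ C, ∀ l ∈ C, ∑ i ∈ R, conj (Q i k) * Q i l = if k = l then 1 else 0) ∧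
      ∀ i ∈ R, ∀ k ∈ C, X i k = ∑ l ∈ C, Q i l * A l k := by
  classical
  obtain ⟨q, hq, hv⟩ := exists_orthonormal_expansion (E := EuclideanSpace ℂ R) (ι := C)
    (by simpa using hRC) (fun k => WithLp.toLp 2 fun i => X i k)
  refine ⟨fun i k => if h : i ∈ R ∧ k ∈ C then q ⟨k, h.2⟩ ⟨i, h.1⟩ else 0,
    fun l k => if h : l ∈ C then
      inner ℂ (q ⟨l, h⟩) (WithLp.toLp 2 fun i : R => X i k) else 0, ?_, ?_, ?_⟩
  · intro i k hi
    simp [hi]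
  · intro k hk l hl
    have h := orthonormal_iff_ite.mp hq ⟨k, hk⟩ ⟨l, hl⟩
    rw [PiLp.inner_apply] at h
    rw [← Finset.sum_coe_sort R]
    simpa [hk, hl, mul_comm, Subtype.mk.injEq] using h
  · intro i hi k hk
    have h := congrArg (fun w : EuclideanSpace ℂ R => w ⟨i, hi⟩) (hv ⟨k, hk⟩)
    rw [← Finset.sum_coe_sort C]
    simpa [hi, mul_comm] using h

/-- Blockwise QR factorization: the columns `k < n` are grouped by `κ`, and the columns of one
group share the row support `{i | P i k}`. -/
theorem exists_block_qr {K : Type*} {M n : ℕ} {κ : ℕ → K} {P : ℕ → ℕ → Prop}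
    [DecidableEq K] [∀ k, DecidablePred (P · k)]
    (hP : ∀ i k, P i k → i < M ∧ k < n)
    (hPκ : ∀ i k l, κ k = κ l → P i k → P i l)
    (hcard : ∀ k < n, ((Finset.range n).filter (κ · = κ k)).card ≤
      ((Finset.range M).filter (P · k)).card)
    {X : ℕ → ℕ → ℂ} (hX : ∀ i k, ¬ P i k → X i k = 0) :
    ∃ Q A : ℕ → ℕ → ℂ,
      (∀ i k, ¬ P i k → Q i k = 0) ∧ (∀ l k, A l k ≠ 0 → κ l = κ k) ∧
      (∀ k < n, ∀ l < n, κ k = κ l →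
        ∑ i ∈ Finset.range M, conj (Q i k) * Q i l = if k = l then 1 else 0) ∧
      ∀ i, ∀ k < n, X i k = ∑ l ∈ Finset.range n, Q i l * A l k := by
  classical
  have hPκ' : ∀ i k l, κ k = κ l → (P i k ↔ P i l) := fun i k l h =>
    ⟨hPκ i k l h, hPκ i l k h.symm⟩
  have hex : ∀ c : K, ∃ Q A : ℕ → ℕ → ℂ, ∀ k < n, κ k = c →
      (∀ i, ¬ P i k → Q i k = 0) ∧
      (∀ l < n, κ l = c →
        ∑ i ∈ Finset.range M, conj (Q i k) * Q i l = if k = l then 1 else 0) ∧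
      ∀ i, X i k = ∑ l ∈ (Finset.range n).filter (κ · = c), Q i l * A l k := by
    intro c
    by_cases hc : ∃ k < n, κ k = c
    · obtain ⟨k₀, hk₀, rfl⟩ := hc
      obtain ⟨Q, A, hQ, hort, hfac⟩ := exists_thin_qr _ _ (hcard k₀ hk₀) X
      have hQP : ∀ i k, ¬ P i k₀ → Q i k = 0 := fun i k h => hQ i k (by simp [h])
      refine ⟨Q, A, fun k hk hkc => ⟨fun i hi => hQP i k (by rwa [hPκ' i k₀ k hkc.symm]),
        fun l hl hlc => ?_, fun i => ?_⟩⟩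
      · rw [← hort k (by simp [hk, hkc]) l (by simp [hl, hlc])]
        refine (Finset.sum_subset (Finset.filter_subset _ _) fun i hi hi' => ?_).symm
        rw [hQ i l hi', mul_zero]
      · by_cases hi : P i k₀
        · exact hfac i (by simp [hi, (hP i k₀ hi).1]) k (by simp [hk, hkc])
        · rw [hX i k (by rwa [hPκ' i k k₀ hkc])]
          exact (Finset.sum_eq_zero fun l _ => by rw [hQP i l hi, zero_mul]).symm
    · exact ⟨0, 0, fun k hk hkc => (hc ⟨k, hk, hkc⟩).elim⟩
  choose Q A h using hex
  refine ⟨fun i k => if k < n then Q (κ k) i k else 0,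
    fun l k => if κ l = κ k then A (κ k) l k else 0, ?_, ?_, ?_, ?_⟩
  · intro i k hik
    by_cases hk : k < n
    · simpa [hk] using (h _ k hk rfl).1 i hik
    · simp [hk]
  · intro l k hlk
    by_contra hne
    simp [hne] at hlk
  · intro k hk l hl hkl
    simpa [hk, hl, hkl] using (h (κ l) k hk hkl).2.1 l hl rfl
  · intro i k hk
    rw [(h _ k hk rfl).2.2 i, Finset.sum_filter]
    refine Finset.sum_congr rfl fun l hl => ?_
    by_cases hlk : κ l = κ k
    · simp [hlk, Finset.mem_range.mp hl]
    · simp [hlk]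

theorem nmul_eq_sum {f g : ℕ → ℕ → ℂ} {n : ℕ} {i j : ℕ}
    (h : ∀ k, g k j ≠ 0 → k < n) : nmul f g i j = ∑ k ∈ Finset.range n, f i k * g k j :=
  tsum_eq_sum fun k hk => by
    have : g k j = 0 := by
      by_contra hne
      exact hk (Finset.mem_range.mpr (h k hne))
    rw [this, mul_zero]

theorem nfrob_eq_sqrt_sum {f : ℕ → ℕ → ℂ} {m n : ℕ} (h : SuppIn m n f) :
    nfrob f = Real.sqrt (∑ j ∈ Finset.range n, ∑ i ∈ Finset.range m, ‖f i j‖ ^ 2) := by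
  have h0 : ∀ i j, ¬ (i < m ∧ j < n) → f i j = 0 := fun i j hij => by
    by_contra hne
    exact hij (h i j hne)
  have h1 : ∀ i, ∑' j, ‖f i j‖ ^ 2 = ∑ j ∈ Finset.range n, ‖f i j‖ ^ 2 := fun i =>
    tsum_eq_sum fun j hj => by
      rw [h0 i j fun hij => hj (Finset.mem_range.mpr hij.2)]
      simp
  have h2 : ∑' i, ∑' j, ‖f i j‖ ^ 2 = ∑ i ∈ Finset.range m, ∑ j ∈ Finset.range n, ‖f i j‖ ^ 2 := by
    simp_rw [h1]
    refine tsum_eq_sum fun i hi => Finset.sum_eq_zero fun j _ => ?_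
    rw [h0 i j fun hij => hi (Finset.mem_range.mpr hij.1)]
    simp
  rw [nfrob, h2, Finset.sum_comm]

theorem nfrob_flip {f : ℕ → ℕ → ℂ} {m n : ℕ} (h : SuppIn m n f) : nfrob (flip f) = nfrob f := by
  have h' : SuppIn n m (flip f) := fun i j hij => (h j i hij).symm
  rw [nfrob_eq_sqrt_sum h, nfrob_eq_sqrt_sum h', Finset.sum_comm]
  rfl

theorem flip_nmul (f g : ℕ → ℕ → ℂ) : flip (nmul f g) = nmul (flip g) (flip f) := by
  funext i j
  simp only [flip, nmul, mul_comm]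

theorem SuppIn.nmul {m n p : ℕ} {f g : ℕ → ℕ → ℂ} (hf : SuppIn m n f) (hg : SuppIn n p g) :
    SuppIn m p (nmul f g) := by
  intro i j hij
  obtain ⟨k, hk⟩ : ∃ k, f i k * g k j ≠ 0 := by
    by_contra! h
    exact hij (by simp [_root_.nmul, h])
  exact ⟨(hf i k (left_ne_zero_of_mul hk)).1, (hg k j (right_ne_zero_of_mul hk)).2⟩

/-- Left multiplication by `Q` preserves the Frobenius norm of `Z` when the columns of `Q` that
meet a common column of `Z` are orthonormal. -/
theorem nfrob_nmul_eq {m n p : ℕ} {Q Z : ℕ → ℕ → ℂ} (hQ : SuppIn m n Q) (hZ : SuppIn n p Z)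
    (hort : ∀ j k l, Z k j ≠ 0 → Z l j ≠ 0 →
      ∑ i ∈ Finset.range m, conj (Q i k) * Q i l = if k = l then 1 else 0) :
    nfrob (nmul Q Z) = nfrob Z := by
  rw [nfrob_eq_sqrt_sum (hQ.nmul hZ), nfrob_eq_sqrt_sum hZ]
  congr 1
  refine Finset.sum_congr rfl fun j _ => ?_
  rw [← Complex.ofReal_inj]
  push_cast
  simp_rw [← Complex.conj_mul', nmul_eq_sum (fun k hk => (hZ k j hk).1), map_sum,
    Finset.sum_mul_sum]
  rw [Finset.sum_comm]
  refine Finset.sum_congr rfl fun k hk => ?_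
  rw [Finset.sum_comm]
  have key : ∀ l, ∑ i ∈ Finset.range m, conj (Q i k * Z k j) * (Q i l * Z l j) =
      if k = l then conj (Z k j) * Z l j else 0 := by
    intro l
    have : ∀ i, conj (Q i k * Z k j) * (Q i l * Z l j) =
        conj (Q i k) * Q i l * (conj (Z k j) * Z l j) := fun i => by
      rw [map_mul]
      ring
    simp_rw [this, ← Finset.sum_mul]
    by_cases hz : Z k j ≠ 0 ∧ Z l j ≠ 0
    · rw [hort j k l hz.1 hz.2, ite_mul, one_mul, zero_mul]
    · have h0 : conj (Z k j) * Z l j = 0 := by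
        rw [not_and_or, not_not, not_not] at hz
        rcases hz with h | h <;> simp [h]
      simp [h0]
  simp_rw [key]
  simp [Finset.mem_range.mp hk]

/-- Moving the triangular factors of a blockwise QR factorization of `X` into `Y`. -/
theorem exists_orthonormalization {K : Type*} {M n : ℕ} {κ : ℕ → K} {P S : ℕ → ℕ → Prop}
    [DecidableEq K] [∀ k, DecidablePred (P · k)]
    (hP : ∀ i k, P i k → i < M ∧ k < n)
    (hPκ : ∀ i k l, κ k = κ l → P i k → P i l)
    (hS : ∀ k j, S k j → k < n)
    (hSκ : ∀ k l j, κ k = κ l → S k j → S l j)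
    (hcard : ∀ k < n, ((Finset.range n).filter (κ · = κ k)).card ≤
      ((Finset.range M).filter (P · k)).card)
    {X Y : ℕ → ℕ → ℂ} (hX : ∀ i k, ¬ P i k → X i k = 0) (hY : ∀ k j, ¬ S k j → Y k j = 0) :
    ∃ Q Z : ℕ → ℕ → ℂ, (∀ i k, ¬ P i k → Q i k = 0) ∧ (∀ k j, ¬ S k j → Z k j = 0) ∧
      nmul Q Z = nmul X Y ∧
      ∀ k < n, ∀ l < n, κ k = κ l →
        ∑ i ∈ Finset.range M, conj (Q i k) * Q i l = if k = l then 1 else 0 := by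
  obtain ⟨Q, A, hQ, hA, hort, hfac⟩ := exists_block_qr hP hPκ hcard hX
  have hYn : ∀ j k, Y k j ≠ 0 → k < n := fun j k h => by
    by_contra hk
    exact h (hY k j fun hs => hk (hS k j hs))
  have hZ : ∀ k j, ¬ S k j → nmul A Y k j = 0 := fun k j hkj => by
    rw [nmul_eq_sum (hYn j)]
    refine Finset.sum_eq_zero fun l _ => ?_
    by_contra h
    refine right_ne_zero_of_mul h (hY l j fun hs => hkj ?_)
    exact hSκ l k j (hA k l (left_ne_zero_of_mul h)).symm hs
  refine ⟨Q, nmul A Y, hQ, hZ, ?_, hort⟩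
  funext i j
  have hZn : ∀ k, nmul A Y k j ≠ 0 → k < n := fun k h => by
    by_contra hk
    exact h (hZ k j fun hs => hk (hS k j hs))
  rw [nmul_eq_sum hZn, nmul_eq_sum (hYn j)]
  simp_rw [nmul_eq_sum (hYn j), Finset.mul_sum]
  rw [Finset.sum_comm]
  refine Finset.sum_congr rfl fun k hk => ?_
  rw [hfac i k (Finset.mem_range.mp hk), Finset.sum_mul]
  exact Finset.sum_congr rfl fun l _ => (mul_assoc _ _ _).symm

/-- The support of a pattern, in arithmetic form. -/
def Pattern.Supp (π : Pattern) (i j : ℕ) : Prop :=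
  (i < π.rows ∧ j < π.cols) ∧ i / π.d / π.b = j / π.d / π.c ∧ i % π.d = j % π.d

instance (π : Pattern) (i j : ℕ) : Decidable (π.Supp i j) :=
  inferInstanceAs (Decidable (_ ∧ _))

theorem SpatN_eq_zero_iff (π : Pattern) (i j : ℕ) : SpatN π i j = 0 ↔ ¬ π.Supp i j := by
  unfold SpatN Pattern.Supp
  by_cases h : i < π.rows ∧ j < π.cols
  · have hS : π.S ⟨i, h.1⟩ ⟨j, h.2⟩ =
        (1 : Matrix (Fin π.a) (Fin π.a) ℕ) ((kron3Equiv π.a π.b π.d).symm ⟨i, h.1⟩).1.1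
          ((kron3Equiv π.a π.c π.d).symm ⟨j, h.2⟩).1.1 * 1 *
        (1 : Matrix (Fin π.d) (Fin π.d) ℕ) ((kron3Equiv π.a π.b π.d).symm ⟨i, h.1⟩).2
          ((kron3Equiv π.a π.c π.d).symm ⟨j, h.2⟩).2 := rfl
    rw [dif_pos h, hS]
    simpa [h, kron3Equiv, Matrix.one_apply, Fin.ext_iff] using imp_not_comm
  · simp [h]

theorem IsFactorN_iff {π : Pattern} {X : ℕ → ℕ → ℂ} :
    IsFactorN π X ↔ ∀ i j, ¬ π.Supp i j → X i j = 0 := by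
  simp only [IsFactorN, SpatN_eq_zero_iff]

theorem IsFactorN.supp {π : Pattern} {X : ℕ → ℕ → ℂ} (hX : IsFactorN π X) {i j : ℕ}
    (h : X i j ≠ 0) : π.Supp i j := by
  by_contra hs
  exact h (IsFactorN_iff.mp hX i j hs)

theorem IsFactorN.suppIn {π : Pattern} {X : ℕ → ℕ → ℂ} (hX : IsFactorN π X) :
    SuppIn π.rows π.cols X := fun _ _ h => (hX.supp h).1

/-- The arithmetic content of chainability. -/
theorem Pattern.Chainable.exists_quotients {π π' : Pattern} (h : π.Chainable π')
    (h₁ : π.Pos) (h₂ : π'.Pos) :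
    ∃ q t, π'.a = π.a * q ∧ π.d = π'.d * t ∧ π.c = π.rk π' * q ∧ π'.b = π.rk π' * t ∧
      0 < π.rk π' := by
  obtain ⟨hac, hbd, hr, hpos, ⟨q, hq⟩, ⟨t, ht⟩⟩ := h
  have e1 : π.a * π.c = π.rk π' * π'.a := (Nat.div_mul_cancel hac).symm
  have e2 : π'.b * π'.d = π.rk π' * π.d := by
    rw [Pattern.rk, hr]
    exact (Nat.div_mul_cancel hbd).symm
  refine ⟨q, t, hq, ht, ?_, ?_, hpos⟩
  · apply Nat.eq_of_mul_eq_mul_left h₁.1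
    rw [e1, hq]
    ring
  · apply Nat.eq_of_mul_eq_mul_right h₂.2.2.2
    rw [e2, ht]
    ring

/-- The group of the inner index `k`: the columns of the left factor (resp. rows of the right one)
in one group share their support, and a group has `r` elements. -/
def innerClass (r d k : ℕ) : ℕ × ℕ := (k / d / r, k % d)

section Chainable

variable {π π' : Pattern}

theorem Pattern.Chainable.cols_eq_rows (h : π.Chainable π') (h₁ : π.Pos) (h₂ : π'.Pos) :
    π.cols = π'.rows := by
  obtain ⟨q, t, ha, hd, hc, hb, -⟩ := h.exists_quotients h₁ h₂
  rw [Pattern.cols, Pattern.rows, ha, hd, hc, hb]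
  ring

theorem Pattern.Chainable.supp_left_iff (h : π.Chainable π') (h₁ : π.Pos) (h₂ : π'.Pos)
    {i k : ℕ} : π.Supp i k ↔ (i < π.rows ∧ k / π.d / π.rk π' < π'.a) ∧
      i / π.d / π.b = k / π.d / π.rk π' / (π.c / π.rk π') ∧ i % π.d = k % π.d := by
  obtain ⟨q, t, ha, hd, hc, hb, hr⟩ := h.exists_quotients h₁ h₂
  have hcr : π.c / π.rk π' = q := by rw [hc, Nat.mul_div_cancel_left _ hr]
  have hcols : π.cols = π'.a * π.rk π' * π.d := by
    rw [Pattern.cols, ha, hc]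
    ring
  rw [Pattern.Supp, hcr, Nat.div_div_eq_div_mul (k / π.d), ← hc, Nat.div_lt_iff_lt_mul hr,
    Nat.div_lt_iff_lt_mul h₁.2.2.2, hcols]

theorem Pattern.Chainable.supp_right_iff (h : π.Chainable π') (h₁ : π.Pos) (h₂ : π'.Pos)
    {k j : ℕ} : π'.Supp k j ↔ (k / π.d / π.rk π' < π'.a ∧ j < π'.cols) ∧
      k / π.d / π.rk π' = j / π'.d / π'.c ∧ k % π.d % π'.d = j % π'.d := by
  obtain ⟨q, t, ha, hd, hc, hb, hr⟩ := h.exists_quotients h₁ h₂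
  have hrows : π'.rows = π'.a * π.rk π' * π.d := by
    rw [Pattern.rows, hd, hb]
    ring
  have hdiv : k / π'.d / π'.b = k / π.d / π.rk π' := by
    rw [Nat.div_div_eq_div_mul, Nat.div_div_eq_div_mul, hd, hb]
    congr 1
    ring
  rw [Pattern.Supp, hdiv, Nat.mod_mod_of_dvd _ ⟨t, hd⟩, Nat.div_lt_iff_lt_mul hr,
    Nat.div_lt_iff_lt_mul h₁.2.2.2, hrows]

theorem Pattern.Chainable.supp_left_congr (h : π.Chainable π') (h₁ : π.Pos) (h₂ : π'.Pos)
    {i k l : ℕ} (hkl : innerClass (π.rk π') π.d k = innerClass (π.rk π') π.d l)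
    (hs : π.Supp i k) : π.Supp i l := by
  obtain ⟨e1, e2⟩ := Prod.mk.inj hkl
  rw [h.supp_left_iff h₁ h₂] at hs ⊢
  rwa [← e1, ← e2]

theorem Pattern.Chainable.supp_right_congr (h : π.Chainable π') (h₁ : π.Pos) (h₂ : π'.Pos)
    {k l j : ℕ} (hkl : innerClass (π.rk π') π.d k = innerClass (π.rk π') π.d l)
    (hs : π'.Supp k j) : π'.Supp l j := by
  obtain ⟨e1, e2⟩ := Prod.mk.inj hkl
  rw [h.supp_right_iff h₁ h₂] at hs ⊢
  rwa [← e1, ← e2]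

/-- Distinct groups of inner indices contribute to disjoint blocks of the product. -/
theorem Pattern.Chainable.innerClass_eq (h : π.Chainable π') (h₁ : π.Pos) (h₂ : π'.Pos)
    {i k l j : ℕ} (hk : π.Supp i k) (hl : π.Supp i l) (hk' : π'.Supp k j) (hl' : π'.Supp l j) :
    innerClass (π.rk π') π.d k = innerClass (π.rk π') π.d l := by
  rw [h.supp_right_iff h₁ h₂] at hk' hl'
  exact Prod.ext (hk'.2.1.trans hl'.2.1.symm) (hk.2.2.symm.trans hl.2.2)

end Chainable

theorem card_innerClass_le {r : ℕ} (hr : 0 < r) (d n k : ℕ) :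
    ((Finset.range n).filter (innerClass r d · = innerClass r d k)).card ≤ r := by
  conv_rhs => rw [← Finset.card_range r]
  refine Finset.card_le_card_of_injOn (fun l => l / d % r)
    (fun l _ => by simpa using Nat.mod_lt _ hr) fun l hl l' hl' hll => ?_
  simp only [Finset.coe_filter, Set.mem_ofPred_eq] at hl hl'
  obtain ⟨e1, e2⟩ := Prod.mk.inj (hl.2.trans hl'.2.symm)
  have e3 : l / d = l' / d := by
    rw [← Nat.div_add_mod (l / d) r, e1, show l / d % r = l' / d % r from hll, Nat.div_add_mod]
  rw [← Nat.div_add_mod l d, e3, e2, Nat.div_add_mod]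

theorem le_card_supp_col {π : Pattern} (h : π.Pos) {k : ℕ} (hk : k < π.cols) :
    π.b ≤ ((Finset.range π.rows).filter (π.Supp · k)).card := by
  obtain ⟨-, hb, hc, hd⟩ := h
  have hmod := Nat.mod_lt k hd
  have hdiv : ∀ x, (x * π.d + k % π.d) / π.d = x := fun x => by
    rw [mul_comm, Nat.mul_add_div hd, Nat.div_eq_of_lt hmod, add_zero]
  conv_lhs => rw [← Finset.card_range π.b]
  refine Finset.card_le_card_of_injOn (fun β => (k / π.d / π.c * π.b + β) * π.d + k % π.d)
    (fun β hβ => ?_) fun β _ β' _ hββ => ?_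
  · have hβ' : β < π.b := by simpa using hβ
    have e : (k / π.d / π.c * π.b + β) / π.b = k / π.d / π.c := by
      rw [mul_comm, Nat.mul_add_div hb, Nat.div_eq_of_lt hβ', add_zero]
    have hα : k / π.d / π.c < π.a := by
      rwa [Nat.div_lt_iff_lt_mul hc, Nat.div_lt_iff_lt_mul hd]
    have hlt : (k / π.d / π.c * π.b + β) * π.d + k % π.d < π.rows := by
      rw [Pattern.rows, ← Nat.div_lt_iff_lt_mul hd, hdiv, ← Nat.div_lt_iff_lt_mul hb, e]
      exact hα
    have hsupp : π.Supp ((k / π.d / π.c * π.b + β) * π.d + k % π.d) k :=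
      ⟨⟨hlt, hk⟩, by rw [hdiv, e], by simp⟩
    simpa using And.intro hlt hsupp
  · have := congrArg (· / π.d) hββ
    simp only [hdiv] at this
    omega

theorem le_card_supp_row {π : Pattern} (h : π.Pos) {k : ℕ} (hk : k < π.rows) :
    π.c ≤ ((Finset.range π.cols).filter (π.Supp k ·)).card := by
  refine (le_card_supp_col (π := ⟨π.a, π.c, π.b, π.d⟩) ⟨h.1, h.2.2.1, h.2.1, h.2.2.2⟩ hk).trans
    (Finset.card_le_card fun j hj => ?_)
  rw [Finset.mem_filter] at hj ⊢
  exact ⟨hj.1, hj.2.1.symm, hj.2.2.1.symm, hj.2.2.2.symm⟩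

/-- Columns of `Q` in one group are orthonormal: `Q` is left-unitary. -/
theorem leftRUnitary_of_orthonormal {π : Pattern} (hπ : π.Pos) {r : ℕ} (hr : r ∣ π.c)
    {Q : ℕ → ℕ → ℂ} (hQ : IsFactorN π Q)
    (hort : ∀ k < π.cols, ∀ l < π.cols, innerClass r π.d k = innerClass r π.d l →
      ∑ i ∈ Finset.range π.rows, conj (Q i k) * Q i l = if k = l then 1 else 0) :
    LeftRUnitary π r Q := by
  refine ⟨hr, fun π' hπ' hch hrk Z hZ => ?_⟩
  subst hrk
  have hcr := hch.cols_eq_rows hπ hπ'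
  refine nfrob_nmul_eq hQ.suppIn (hcr ▸ hZ.suppIn) fun j k l hk hl => ?_
  have hk' := hZ.supp hk
  have hl' := hZ.supp hl
  by_cases hkl : innerClass (π.rk π') π.d k = innerClass (π.rk π') π.d l
  · exact hort k (hcr ▸ hk'.1.1) l (hcr ▸ hl'.1.1) hkl
  · rw [if_neg fun e => hkl (by rw [e])]
    refine Finset.sum_eq_zero fun i _ => ?_
    by_contra hne
    have hk'' : π.Supp i k := hQ.supp fun h0 => hne (by simp [h0])
    have hl'' : π.Supp i l := hQ.supp fun h0 => hne (by simp [h0])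
    exact hkl (hch.innerClass_eq hπ hπ' hk'' hl'' hk' hl')

/-- Rows of `Q` in one group are orthonormal: `Q` is right-unitary. -/
theorem rightRUnitary_of_orthonormal {π' : Pattern} (hπ' : π'.Pos) {r d : ℕ} (hr : r ∣ π'.b)
    (hd : π'.b * π'.d = r * d) (hr0 : 0 < r) {Q : ℕ → ℕ → ℂ} (hQ : IsFactorN π' Q)
    (hort : ∀ k < π'.rows, ∀ l < π'.rows, innerClass r d k = innerClass r d l →
      ∑ j ∈ Finset.range π'.cols, conj (Q k j) * Q l j = if k = l then 1 else 0) :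
    RightRUnitary π' r Q := by
  refine ⟨hr, fun π hπ hch hrk Z hZ => ?_⟩
  subst hrk
  have hcr := hch.cols_eq_rows hπ hπ'
  obtain ⟨q, t, -, ht, -, hb, -⟩ := hch.exists_quotients hπ hπ'
  obtain rfl : π.d = d := by
    apply Nat.eq_of_mul_eq_mul_left hr0
    rw [← hd, ht, hb]
    ring
  have hQs := hQ.suppIn
  have hZs : SuppIn π.rows π'.rows Z := hcr ▸ hZ.suppIn
  rw [← nfrob_flip (hZs.nmul hQs), ← nfrob_flip hZs, flip_nmul]
  refine nfrob_nmul_eq (fun i j h => (hQs j i h).symm) (fun i j h => (hZs j i h).symm)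
    fun i k l hk hl => ?_
  have hk' := hZ.supp hk
  have hl' := hZ.supp hl
  by_cases hkl : innerClass (π.rk π') π.d k = innerClass (π.rk π') π.d l
  · exact hort k (hcr ▸ hk'.1.2) l (hcr ▸ hl'.1.2) hkl
  · rw [if_neg fun e => hkl (by rw [e])]
    refine Finset.sum_eq_zero fun j _ => ?_
    by_contra hne
    have hk'' : π'.Supp k j := hQ.supp fun h0 => hne (by simp [flip, h0])
    have hl'' : π'.Supp l j := hQ.supp fun h0 => hne (by simp [flip, h0])
    exact hkl (hch.innerClass_eq hπ hπ' hk' hl' hk'' hl'')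

/-- **Lemma (pseudo-orthonormalization).** For a chainable non-redundant pair `(π, π')` and
factors `X ∈ D^π`, `Y ∈ D^{π'}`, there exist factors with the same product such that the
left one is left-`r(π,π')`-unitary, and factors with the same product such that the right
one is right-`r(π,π')`-unitary. -/
theorem pseudo_orthonormalization (π π' : Pattern)
    (h₁ : π.Pos) (h₂ : π'.Pos) (hch : Pattern.Chainable π π')
    (hnr : ¬ RedundantPair π π')
    (X Y : ℕ → ℕ → ℂ) (hX : IsFactorN π X) (hY : IsFactorN π' Y) :
    (∃ X' Y' : ℕ → ℕ → ℂ, IsFactorN π X' ∧ IsFactorN π' Y' ∧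
      nmul X' Y' = nmul X Y ∧ LeftRUnitary π (Pattern.rk π π') X') ∧
    (∃ X' Y' : ℕ → ℕ → ℂ, IsFactorN π X' ∧ IsFactorN π' Y' ∧
      nmul X' Y' = nmul X Y ∧ RightRUnitary π' (Pattern.rk π π') Y') := by
  obtain ⟨q, t, -, hd, hc, hb, hr⟩ := hch.exists_quotients h₁ h₂
  have hcr := hch.cols_eq_rows h₁ h₂
  obtain ⟨hrb, hrc⟩ := lt_min_iff.mp (not_le.mp hnr)
  rw [IsFactorN_iff] at hX hY
  constructor
  · obtain ⟨Q, Z, hQ, hZ, hQZ, hort⟩ := exists_orthonormalization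
      (κ := innerClass (π.rk π') π.d) (P := π.Supp) (S := π'.Supp)
      (fun _ _ h => h.1) (fun _ _ _ => hch.supp_left_congr h₁ h₂) (fun _ _ h => hcr ▸ h.1.1)
      (fun _ _ _ => hch.supp_right_congr h₁ h₂)
      (fun k hk => ((card_innerClass_le hr _ _ k).trans hrb.le).trans (le_card_supp_col h₁ hk))
      hX hY
    exact ⟨Q, Z, IsFactorN_iff.mpr hQ, IsFactorN_iff.mpr hZ, hQZ,
      leftRUnitary_of_orthonormal h₁ ⟨q, hc⟩ (IsFactorN_iff.mpr hQ) hort⟩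
  · obtain ⟨Q, Z, hQ, hZ, hQZ, hort⟩ := exists_orthonormalization
      (κ := innerClass (π.rk π') π.d) (P := fun j k => π'.Supp k j) (S := fun k i => π.Supp i k)
      (X := flip Y) (Y := flip X) (M := π'.cols) (n := π'.rows)
      (fun _ _ h => h.1.symm) (fun _ _ _ => hch.supp_right_congr h₁ h₂)
      (fun _ _ h => hcr ▸ h.1.2) (fun _ _ _ => hch.supp_left_congr h₁ h₂)
      (fun k hk => ((card_innerClass_le hr _ _ k).trans hrc.le).trans (le_card_supp_row h₂ hk))
      (fun _ _ => hY _ _) (fun _ _ => hX _ _)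
    have hQ' : IsFactorN π' (flip Q) := IsFactorN_iff.mpr fun i j h => hQ j i h
    refine ⟨flip Z, flip Q, IsFactorN_iff.mpr fun i j h => hZ j i h, hQ', ?_,
      rightRUnitary_of_orthonormal h₂ ⟨t, hb⟩ ?_ hr hQ' hort⟩
    · rw [← flip_nmul, hQZ, ← flip_nmul]
      rfl
    · rw [hb, hd]
      ring
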